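/- arXiv:1906.05821 — 3 statements merged into one kernel-verified Lean document; each statement's English description precedes it below -/
import Mathlib

section
/- For every point (x,y) ∈ ℝ^l × ℝ^m and every pair of tangent vectors ξ, η of the torus ψ at (x,y) (real linear combinations of the partial derivatives of ψ at (x,y)), one has Σ_{d=1}^n Re(ξ_d · k · conj(η_d)) = 0; equivalently, the k-component of Σ_{d=1}^n conj(ξ_d) · η_d is zero. (This is the ω_K-isotropy of the torus T^{l,m}, where the complex structure K acts by right multiplication by k.) -/
open scoped Quaternion
open Matrix

noncomputable section

/-- `exp(t·j) = cos t + (sin t)·j` -/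
def expJ (t : ℝ) : ℍ[ℝ] := ⟨Real.cos t, 0, Real.sin t, 0⟩
/-- `exp(t·k) = cos t + (sin t)·k` -/
def expK (t : ℝ) : ℍ[ℝ] := ⟨Real.cos t, 0, 0, Real.sin t⟩
def qi : ℍ[ℝ] := ⟨0, 1, 0, 0⟩
def qj : ℍ[ℝ] := ⟨0, 0, 1, 0⟩
def qk : ℍ[ℝ] := ⟨0, 0, 0, 1⟩

variable {n l m : ℕ}

/-- the torus map ψ -/
def psi (r : Fin n → ℝ) (e : Fin n → Fin l → ℝ) (f : Fin n → Fin m → ℝ)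
    (x : Fin l → ℝ) (y : Fin m → ℝ) (d : Fin n) : ℍ[ℝ] :=
  ((r d : ℝ) : ℍ[ℝ]) * expJ (∑ i, e d i * x i) * expK (∑ i, f d i * y i)

/-- ∂ψ/∂x_p -/
def dpsiX (r : Fin n → ℝ) (e : Fin n → Fin l → ℝ) (f : Fin n → Fin m → ℝ)
    (x : Fin l → ℝ) (y : Fin m → ℝ) (p : Fin l) (d : Fin n) : ℍ[ℝ] :=
  ((r d * e d p : ℝ) : ℍ[ℝ]) * (qj * expJ (∑ i, e d i * x i) * expK (∑ i, f d i * y i))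

/-- ∂ψ/∂y_q -/
def dpsiY (r : Fin n → ℝ) (e : Fin n → Fin l → ℝ) (f : Fin n → Fin m → ℝ)
    (x : Fin l → ℝ) (y : Fin m → ℝ) (q : Fin m) (d : Fin n) : ℍ[ℝ] :=
  ((r d * f d q : ℝ) : ℍ[ℝ]) * (expJ (∑ i, e d i * x i) * (qk * expK (∑ i, f d i * y i)))

/-- the tangent space of the torus at the point ψ(x,y): the real span of the partials -/
def tangentSpan (r : Fin n → ℝ) (e : Fin n → Fin l → ℝ) (f : Fin n → Fin m → ℝ)
    (x : Fin l → ℝ) (y : Fin m → ℝ) : Submodule ℝ (Fin n → ℍ[ℝ]) :=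
  Submodule.span ℝ (Set.range (Sum.elim (dpsiX r e f x y) (dpsiY r e f x y)))

/-- the block G₁ of the induced metric -/
def G1 (r : Fin n → ℝ) (e : Fin n → Fin l → ℝ) : Matrix (Fin l) (Fin l) ℝ :=
  ∑ d, (r d) ^ 2 • Matrix.vecMulVec (e d) (e d)

/-- the block G₂ of the induced metric -/
def G2 (r : Fin n → ℝ) (f : Fin n → Fin m → ℝ) : Matrix (Fin m) (Fin m) ℝ :=
  ∑ d, (r d) ^ 2 • Matrix.vecMulVec (f d) (f d)

/-- α_d = ⟨G₁⁻¹ e_d, e_d⟩ + ⟨G₂⁻¹ f_d, f_d⟩ -/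
def alpha (r : Fin n → ℝ) (e : Fin n → Fin l → ℝ) (f : Fin n → Fin m → ℝ) (d : Fin n) : ℝ :=
  (G1 r e)⁻¹ *ᵥ e d ⬝ᵥ e d + (G2 r f)⁻¹ *ᵥ f d ⬝ᵥ f d

/-- ∂²ψ/∂x_p∂x_q -/
def d2psiXX (r : Fin n → ℝ) (e : Fin n → Fin l → ℝ) (f : Fin n → Fin m → ℝ)
    (x : Fin l → ℝ) (y : Fin m → ℝ) (p q : Fin l) (d : Fin n) : ℍ[ℝ] :=
  ((r d * (e d p * e d q) : ℝ) : ℍ[ℝ]) *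
    (qj * qj * expJ (∑ i, e d i * x i) * expK (∑ i, f d i * y i))

/-- ∂²ψ/∂y_r∂y_s -/
def d2psiYY (r : Fin n → ℝ) (e : Fin n → Fin l → ℝ) (f : Fin n → Fin m → ℝ)
    (x : Fin l → ℝ) (y : Fin m → ℝ) (p q : Fin m) (d : Fin n) : ℍ[ℝ] :=
  ((r d * (f d p * f d q) : ℝ) : ℍ[ℝ]) *
    (expJ (∑ i, e d i * x i) * (qk * qk * expK (∑ i, f d i * y i)))

/-- the Laplace–Beltrami operator of the flat torus applied to ψ -/
def lap (r : Fin n → ℝ) (e : Fin n → Fin l → ℝ) (f : Fin n → Fin m → ℝ)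
    (x : Fin l → ℝ) (y : Fin m → ℝ) (d : Fin n) : ℍ[ℝ] :=
  (∑ p, ∑ q, (G1 r e)⁻¹ p q • d2psiXX r e f x y p q d) +
  (∑ p, ∑ q, (G2 r f)⁻¹ p q • d2psiYY r e f x y p q d)

/-- rk_ℤ⟨v_1, …, v_n⟩ : rank of the additive subgroup generated by the `v d` -/
def zrank {k : ℕ} (v : Fin n → (Fin k → ℝ)) : ℕ :=
  Module.finrank ℤ (Submodule.span ℤ (Set.range v))


lemma expJ_components (t : ℝ) : (expJ t).re = Real.cos t ∧ (expJ t).imI = 0 ∧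
    (expJ t).imJ = Real.sin t ∧ (expJ t).imK = 0 :=
  ⟨rfl, rfl, rfl, rfl⟩

lemma expK_components (t : ℝ) : (expK t).re = Real.cos t ∧ (expK t).imI = 0 ∧
    (expK t).imJ = 0 ∧ (expK t).imK = Real.sin t :=
  ⟨rfl, rfl, rfl, rfl⟩

lemma qj_components : qj.re = 0 ∧ qj.imI = 0 ∧
    qj.imJ = 1 ∧ qj.imK = 0 :=
  ⟨rfl, rfl, rfl, rfl⟩

lemma qk_components : qk.re = 0 ∧ qk.imI = 0 ∧
    qk.imJ = 0 ∧ qk.imK = 1 :=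
  ⟨rfl, rfl, rfl, rfl⟩

/-- Each component of a tangent vector has the form `exp(sj) (a j + b k) exp(tk)`. -/
lemma exists_eq_of_mem_tangentSpan {n l m : ℕ} {r : Fin n → ℝ} {e : Fin n → Fin l → ℝ}
    {f : Fin n → Fin m → ℝ} {x : Fin l → ℝ} {y : Fin m → ℝ} {ξ : Fin n → ℍ[ℝ]}
    (hξ : ξ ∈ tangentSpan r e f x y) (d : Fin n) :
    ∃ a b : ℝ, ξ d = expJ (∑ i, e d i * x i) * (a • qj + b • qk) *
      expK (∑ i, f d i * y i) := by
  induction hξ using Submodule.span_induction with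
  | mem v hv =>
    obtain ⟨p | q, rfl⟩ := hv
    · refine ⟨r d * e d p, 0, ?_⟩
      ext <;> simp [dpsiX, expJ_components, expK_components, qj_components]
    · refine ⟨0, r d * f d q, ?_⟩
      ext <;> simp [dpsiY, expJ_components, expK_components, qk_components]
  | zero => exact ⟨0, 0, by simp⟩
  | add u v _ _ hu hv =>
    obtain ⟨a, b, hu⟩ := hu
    obtain ⟨a', b', hv⟩ := hv
    refine ⟨a + a', b + b', ?_⟩
    rw [Pi.add_apply, hu, hv, ← add_mul, ← mul_add]
    congr 2
    module
  | smul c v _ hv =>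
    obtain ⟨a, b, hv⟩ := hv
    refine ⟨c * a, c * b, ?_⟩
    rw [Pi.smul_apply, hv, mul_smul, mul_smul, ← smul_add, mul_smul_comm, smul_mul_assoc]

/-- The form `Re(ξ k η̄)` vanishes on the plane `exp(sj) span(j, k) exp(tk)`. -/
lemma re_mul_qk_mul_star_eq_zero (s t a b a' b' : ℝ) :
    (expJ s * (a • qj + b • qk) * expK t * qk *
      star (expJ s * (a' • qj + b' • qk) * expK t)).re = 0 := by
  simp [expJ_components, expK_components, qj_components, qk_components]
  ring

/-- ω_K-isotropy of the torus T^{l,m}: for tangent vectors ξ, η at any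
point, Σ_d Re(ξ_d · k · conj(η_d)) = 0. -/
theorem stmt1 (n l m : ℕ) (hn : 1 ≤ n) (hl : 1 ≤ l) (hm : 1 ≤ m)
    (r : Fin n → ℝ) (hr : ∀ d, 0 < r d)
    (e : Fin n → Fin l → ℝ) (f : Fin n → Fin m → ℝ)
    (x : Fin l → ℝ) (y : Fin m → ℝ)
    (ξ η : Fin n → ℍ[ℝ])
    (hξ : ξ ∈ tangentSpan r e f x y) (hη : η ∈ tangentSpan r e f x y) :
    ∑ d, (ξ d * qk * star (η d)).re = 0 := by
  refine Finset.sum_eq_zero fun d _ => ?_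
  obtain ⟨a, b, hξd⟩ := exists_eq_of_mem_tangentSpan hξ d
  obtain ⟨a', b', hηd⟩ := exists_eq_of_mem_tangentSpan hη d
  rw [hξd, hηd]
  exact re_mul_qk_mul_star_eq_zero _ _ _ _ _ _

end
end

section
/- Assume Σ_{d=1}^n r_d² = 1 (so the torus lies in the unit sphere), r_d > 0 for all d, that e_1, …, e_n span ℝ^l and generate a discrete additive subgroup of ℝ^l, and that f_1, …, f_n span ℝ^m. Let Ĥ : ℝ^l × ℝ^m → ℍ^n be the mean curvature field of the torus in the unit sphere, Ĥ_d(x,y) = (1 − α_d/(l+m)) ψ_d(x,y). Then for every (x,y) the vector j·Ĥ(x,y) (componentwise left multiplication by j) lies in the real span of the partial derivatives ∂ψ/∂x_1, …, ∂ψ/∂x_l, ∂ψ/∂y_1, …, ∂ψ/∂y_m at (x,y) if and only if rk_ℤ⟨e''_1, …, e''_n⟩ = l, where e''_d := (e_d; α_d − (l+m)) ∈ ℝ^{l+1}. -/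
open scoped Quaternion
open Matrix

noncomputable section

variable {n l m : ℕ}

/-- The vectors `j·eʲˢ·eᵏᵗ` and `eʲˢ·k·eᵏᵗ` are orthonormal in `ℍ`. -/
theorem eq_of_smul_eq_smul_add_smul (s t u v w : ℝ)
    (h : u • (qj * expJ s * expK t) = v • (qj * expJ s * expK t) + w • (expJ s * (qk * expK t))) :
    u = v := by
  have h0 := congrArg QuaternionAlgebra.re h
  have h1 := congrArg QuaternionAlgebra.imI h
  have h2 := congrArg QuaternionAlgebra.imJ h
  have h3 := congrArg QuaternionAlgebra.imK h
  simp only [Quaternion.re_add, Quaternion.imI_add, Quaternion.imJ_add, Quaternion.imK_add,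
    Quaternion.re_smul, Quaternion.imI_smul, Quaternion.imJ_smul, Quaternion.imK_smul,
    Quaternion.re_mul, Quaternion.imI_mul, Quaternion.imJ_mul, Quaternion.imK_mul,
    smul_eq_mul] at h0 h1 h2 h3
  simp only [qj, qk, expJ, expK] at h0 h1 h2 h3
  have hs := Real.sin_sq_add_cos_sq s
  have ht := Real.sin_sq_add_cos_sq t
  have key : (u - v) *
      ((Real.sin s ^ 2 + Real.cos s ^ 2) * (Real.sin t ^ 2 + Real.cos t ^ 2)) = 0 := by
    linear_combination (-(Real.sin s * Real.cos t)) * h0 + Real.cos s * Real.sin t * h1 +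
      Real.cos s * Real.cos t * h2 - Real.sin s * Real.sin t * h3
  rw [hs, ht] at key
  linarith

/-- A vector `d ↦ κ_d · jψ_d` is tangent to the torus iff `κ_d` is a linear functional of `e_d`. -/
theorem smul_qj_psi_mem_tangentSpan_iff (r : Fin n → ℝ) (hr : ∀ d, r d ≠ 0)
    (e : Fin n → Fin l → ℝ) (f : Fin n → Fin m → ℝ) (x : Fin l → ℝ) (y : Fin m → ℝ)
    (κ : Fin n → ℝ) :
    (fun d => qj * κ d • psi r e f x y d) ∈ tangentSpan r e f x y ↔
      ∃ a : Fin l → ℝ, ∀ d, κ d = e d ⬝ᵥ a := by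
  have hX : ∀ (a : Fin l → ℝ) d, ∑ p, a p • dpsiX r e f x y p d =
      (r d * (e d ⬝ᵥ a)) • (qj * expJ (∑ i, e d i * x i) * expK (∑ i, f d i * y i)) := by
    intro a d
    simp only [dpsiX, dotProduct, Finset.mul_sum, Finset.sum_smul, Quaternion.coe_mul_eq_smul,
      smul_smul]
    exact Finset.sum_congr rfl fun p _ => by congr 1; ring
  have hY : ∀ (b : Fin m → ℝ) d, ∑ q, b q • dpsiY r e f x y q d =
      (r d * (f d ⬝ᵥ b)) • (expJ (∑ i, e d i * x i) * (qk * expK (∑ i, f d i * y i))) := by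
    intro b d
    simp only [dpsiY, dotProduct, Finset.mul_sum, Finset.sum_smul, Quaternion.coe_mul_eq_smul,
      smul_smul]
    exact Finset.sum_congr rfl fun p _ => by congr 1; ring
  have hψ : ∀ d, qj * κ d • psi r e f x y d =
      (r d * κ d) • (qj * expJ (∑ i, e d i * x i) * expK (∑ i, f d i * y i)) := by
    intro d
    simp only [psi, Quaternion.coe_mul_eq_smul, smul_mul_assoc, mul_smul_comm, smul_smul,
      mul_assoc, mul_comm]
  simp only [tangentSpan, Submodule.mem_span_range_iff_exists_fun, Fintype.sum_sum_type,
    Sum.elim_inl, Sum.elim_inr, funext_iff, Pi.add_apply, Finset.sum_apply, Pi.smul_apply, hψ]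
  constructor
  · rintro ⟨c, hc⟩
    refine ⟨fun p => c (.inl p), fun d => mul_left_cancel₀ (hr d) ?_⟩
    have h := hc d
    rw [hX (fun p => c (.inl p)), hY (fun q => c (.inr q))] at h
    exact eq_of_smul_eq_smul_add_smul _ _ _ _ _ h.symm
  · rintro ⟨a, ha⟩
    refine ⟨Sum.elim a 0, fun d => ?_⟩
    simp only [Sum.elim_inl, Sum.elim_inr, hX, Pi.zero_apply, zero_smul, Finset.sum_const_zero,
      add_zero, ha]

/-- A linear surjection between modules of equal finite rank is injective when its source is
torsion-free. -/
theorem injective_of_surjective_of_finrank_eq {M N : Type*} [AddCommGroup M] [AddCommGroup N]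
    [Module.Finite ℤ M] [Module.IsTorsionFree ℤ M] (g : M →ₗ[ℤ] N)
    (hg : Function.Surjective g) (h : Module.finrank ℤ M = Module.finrank ℤ N) :
    Function.Injective g := by
  have h1 := (LinearMap.ker g).finrank_quotient_add_finrank
  rw [(g.quotKerEquivOfSurjective hg).finrank_eq, h] at h1
  rw [← LinearMap.ker_eq_bot, ← Submodule.finrank_eq_zero (R := ℤ)]
  omega

/-- An additive map on a lattice extends to a linear functional on the ambient space. -/
theorem exists_linearMap_extending_of_isZLattice {E : Type*} [NormedAddCommGroup E]
    [NormedSpace ℝ E] [FiniteDimensional ℝ E] (L : Submodule ℤ E) [DiscreteTopology L]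
    [IsZLattice ℝ L] (φ : L →ₗ[ℤ] ℝ) : ∃ Φ : E →ₗ[ℝ] ℝ, ∀ v : L, Φ v = φ v := by
  have := ZLattice.module_free ℝ L
  have := ZLattice.module_finite ℝ L
  let b := Module.Free.chooseBasis ℤ L
  let B := b.ofZLatticeBasis ℝ L
  let Φ : E →ₗ[ℝ] ℝ := B.constr ℝ (fun i => φ (b i))
  refine ⟨Φ, fun v => ?_⟩
  have key : (Φ.restrictScalars ℤ) ∘ₗ L.subtype = φ := by
    refine b.ext fun i => ?_
    have : Φ (B i) = φ (b i) := B.constr_basis ℝ _ i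
    simpa [B] using this
  exact LinearMap.congr_fun key v

/-- For vectors `e_d` generating a lattice, appending `c_d` to `e_d` preserves the rank iff
`c_d` is a linear functional of `e_d`. -/
theorem zrank_snoc_eq_iff (e : Fin n → Fin l → ℝ)
    (hspan : Submodule.span ℝ (Set.range e) = ⊤)
    (hdisc : DiscreteTopology ↥(AddSubgroup.closure (Set.range e))) (c : Fin n → ℝ) :
    zrank (fun d => (Fin.snoc (e d) (c d) : Fin (l + 1) → ℝ)) = l ↔
      ∃ a : Fin l → ℝ, ∀ d, c d = e d ⬝ᵥ a := by
  set L := Submodule.span ℤ (Set.range e) with hL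
  have hLdisc : DiscreteTopology L := by
    have h : (L : Set (Fin l → ℝ)) = AddSubgroup.closure (Set.range e) := by
      rw [hL, ← Submodule.coe_toAddSubgroup, Submodule.span_int_eq_addSubgroupClosure]
    change DiscreteTopology (L : Set (Fin l → ℝ))
    rw [h]
    exact hdisc
  have hLlat : IsZLattice ℝ L := ⟨by rw [hL, Submodule.span_span_of_tower, hspan]⟩
  have hLrank : Module.finrank ℤ L = l := by
    rw [ZLattice.rank ℝ L, Module.finrank_fin_fun]
  set v : Fin n → Fin (l + 1) → ℝ := fun d => Fin.snoc (e d) (c d) with hv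
  set M := Submodule.span ℤ (Set.range v) with hM
  have : Module.Finite ℤ M := Module.Finite.span_of_finite ℤ (Set.finite_range v)
  let P : (Fin (l + 1) → ℝ) →ₗ[ℤ] (Fin l → ℝ) := LinearMap.funLeft ℤ ℝ Fin.castSucc
  have hPv : ∀ d, P (v d) = e d := fun d => by
    ext i
    simp [P, v, LinearMap.funLeft_apply]
  have hmap : M.map P = L := by
    rw [hM, Submodule.map_span, ← Set.range_comp, hL]
    congr 2
    exact funext hPv
  let g : M →ₗ[ℤ] L := P.restrict fun z hz => hmap ▸ Submodule.mem_map_of_mem hz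
  have hg : Function.Surjective g := by
    rintro ⟨w, hw⟩
    obtain ⟨z, hz, rfl⟩ := Submodule.mem_map.1 (hmap.symm ▸ hw)
    exact ⟨⟨z, hz⟩, rfl⟩
  have hvM : ∀ d, v d ∈ M := fun d => Submodule.subset_span ⟨d, rfl⟩
  constructor
  · intro hrank
    have hinj := injective_of_surjective_of_finrank_eq g hg (hrank.trans hLrank.symm)
    let G := LinearEquiv.ofBijective g ⟨hinj, hg⟩
    obtain ⟨Φ, hΦ⟩ := exists_linearMap_extending_of_isZLattice L
      ((LinearMap.proj (Fin.last l) ∘ₗ M.subtype) ∘ₗ G.symm.toLinearMap)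
    refine ⟨fun i => Φ (fun j => if i = j then 1 else 0), fun d => ?_⟩
    have h1 := hΦ (G ⟨v d, hvM d⟩)
    have h2 : ((G ⟨v d, hvM d⟩ : L) : Fin l → ℝ) = e d := hPv d
    rw [h2] at h1
    simp only [LinearMap.comp_apply, LinearEquiv.coe_coe, LinearEquiv.symm_apply_apply] at h1
    have h3 : Φ (e d) = c d := by simpa [v] using h1
    rw [← h3, LinearMap.pi_apply_eq_sum_univ Φ (e d)]
    rfl
  · rintro ⟨a, ha⟩
    have hlast : ∀ z ∈ M, z (Fin.last l) = P z ⬝ᵥ a := by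
      intro z hz
      induction hz using Submodule.span_induction with
      | mem z hz =>
        obtain ⟨d, rfl⟩ := hz
        rw [hPv, ← ha]
        simp [v]
      | zero => simp
      | add y z _ _ hy hz => rw [map_add, add_dotProduct, Pi.add_apply, hy, hz]
      | smul k z _ hz => rw [map_smul, smul_dotProduct, Pi.smul_apply, hz]
    have hinj : Function.Injective g := by
      rintro ⟨y, hy⟩ ⟨z, hz⟩ hyz
      have h : P y = P z := congrArg Subtype.val hyz
      refine Subtype.ext (funext fun i => ?_)
      induction i using Fin.lastCases with
      | last => exact (hlast y hy).trans (h ▸ (hlast z hz).symm)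
      | cast i => exact congrFun h i
    exact (LinearEquiv.ofBijective g ⟨hinj, hg⟩).finrank_eq.trans hLrank

/-- for the torus in the unit sphere, JĤ is tangent iff
rk_ℤ⟨e''_1, …, e''_n⟩ = l, where e''_d = (e_d; α_d − (l+m)). -/
theorem stmt13 (n l m : ℕ) (hn : 1 ≤ n) (hl : 1 ≤ l) (hm : 1 ≤ m)
    (r : Fin n → ℝ) (hr : ∀ d, 0 < r d) (hsum : ∑ d, r d ^ 2 = 1)
    (e : Fin n → Fin l → ℝ) (f : Fin n → Fin m → ℝ)
    (hspanE : Submodule.span ℝ (Set.range e) = ⊤)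
    (hdisc : DiscreteTopology ↥(AddSubgroup.closure (Set.range e)))
    (hspanF : Submodule.span ℝ (Set.range f) = ⊤)
    (Hhat : (Fin l → ℝ) → (Fin m → ℝ) → Fin n → ℍ[ℝ])
    (hHhat : ∀ x y d,
      Hhat x y d = (1 - alpha r e f d / ((l : ℝ) + m)) • psi r e f x y d) :
    (∀ x y, (fun d => qj * Hhat x y d) ∈ tangentSpan r e f x y) ↔
      zrank (fun d => Fin.snoc (e d) (alpha r e f d - ((l : ℝ) + m))) = l := by
  have hpos : (0 : ℝ) < (l : ℝ) + m := by positivity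
  rw [zrank_snoc_eq_iff e hspanE hdisc]
  simp only [hHhat, smul_qj_psi_mem_tangentSpan_iff r (fun d => (hr d).ne'), forall_const]
  constructor
  · rintro ⟨a, ha⟩
    refine ⟨-((l : ℝ) + m) • a, fun d => ?_⟩
    rw [dotProduct_smul, ← ha d, smul_eq_mul]
    field_simp
    ring
  · rintro ⟨a, ha⟩
    refine ⟨-((l : ℝ) + m)⁻¹ • a, fun d => ?_⟩
    rw [dotProduct_smul, ← ha d, smul_eq_mul]
    field_simp
    ring

end
end

section
/- For every (x,y) ∈ ℝ^l × ℝ^m and all indices p ∈ {1,…,l}, q ∈ {1,…,m}: (∂ψ/∂x_p, j·ψ)(x,y) = Σ_{d=1}^n r_d² (e_d)_p and (∂ψ/∂y_q, j·ψ)(x,y) = 0, where j·ψ denotes componentwise left multiplication by j (the fiber direction of the Hopf map induced by the left action of e^{jt}). Consequently, the torus ψ is horizontal with respect to this fibration — i.e., at every point every tangent vector of ψ is orthogonal to j·ψ — if and only if Σ_{d=1}^n r_d² e_d = 0. -/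
open scoped Quaternion
open Matrix

noncomputable section

variable {n l m : ℕ}

@[simp] theorem expJ_re (t : ℝ) : (expJ t).re = Real.cos t := rfl
@[simp] theorem expJ_imI (t : ℝ) : (expJ t).imI = 0 := rfl
@[simp] theorem expJ_imJ (t : ℝ) : (expJ t).imJ = Real.sin t := rfl
@[simp] theorem expJ_imK (t : ℝ) : (expJ t).imK = 0 := rfl

@[simp] theorem expK_re (t : ℝ) : (expK t).re = Real.cos t := rfl
@[simp] theorem expK_imI (t : ℝ) : (expK t).imI = 0 := rfl
@[simp] theorem expK_imJ (t : ℝ) : (expK t).imJ = 0 := rfl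
@[simp] theorem expK_imK (t : ℝ) : (expK t).imK = Real.sin t := rfl

@[simp] theorem qj_re : qj.re = 0 := rfl
@[simp] theorem qj_imI : qj.imI = 0 := rfl
@[simp] theorem qj_imJ : qj.imJ = 1 := rfl
@[simp] theorem qj_imK : qj.imK = 0 := rfl

@[simp] theorem qk_re : qk.re = 0 := rfl
@[simp] theorem qk_imI : qk.imI = 0 := rfl
@[simp] theorem qk_imJ : qk.imJ = 0 := rfl
@[simp] theorem qk_imK : qk.imK = 1 := rfl

theorem re_dpsiX_mul_star {n l m : ℕ} (r : Fin n → ℝ) (e : Fin n → Fin l → ℝ)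
    (f : Fin n → Fin m → ℝ) (x : Fin l → ℝ) (y : Fin m → ℝ) (p : Fin l) (d : Fin n) :
    (dpsiX r e f x y p d * star (qj * psi r e f x y d)).re = r d ^ 2 * e d p := by
  unfold dpsiX psi
  generalize (∑ i, e d i * x i) = s
  generalize (∑ i, f d i * y i) = t
  have hs := Real.sin_sq_add_cos_sq s
  have ht := Real.sin_sq_add_cos_sq t
  simp
  linear_combination (r d ^ 2 * e d p) * (Real.sin t ^ 2 + Real.cos t ^ 2) * hs
    + (r d ^ 2 * e d p) * ht

theorem re_dpsiY_mul_star {n l m : ℕ} (r : Fin n → ℝ) (e : Fin n → Fin l → ℝ)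
    (f : Fin n → Fin m → ℝ) (x : Fin l → ℝ) (y : Fin m → ℝ) (q : Fin m) (d : Fin n) :
    (dpsiY r e f x y q d * star (qj * psi r e f x y d)).re = 0 := by
  unfold dpsiY psi
  generalize (∑ i, e d i * x i) = s
  generalize (∑ i, f d i * y i) = t
  simp
  ring

/-- (∂ψ/∂x_p, jψ) = Σ_d r_d²(e_d)_p, (∂ψ/∂y_q, jψ) = 0; hence the torus
is horizontal for the Hopf fibration induced by left multiplication by e^{jt} iff
Σ_d r_d² e_d = 0. -/
theorem stmt15 (n l m : ℕ) (hn : 1 ≤ n) (hl : 1 ≤ l) (hm : 1 ≤ m)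
    (r : Fin n → ℝ) (hr : ∀ d, 0 < r d)
    (e : Fin n → Fin l → ℝ) (f : Fin n → Fin m → ℝ) :
    (∀ (x : Fin l → ℝ) (y : Fin m → ℝ) (p : Fin l),
        ∑ d, (dpsiX r e f x y p d * star (qj * psi r e f x y d)).re
          = ∑ d, r d ^ 2 * e d p) ∧
    (∀ (x : Fin l → ℝ) (y : Fin m → ℝ) (q : Fin m),
        ∑ d, (dpsiY r e f x y q d * star (qj * psi r e f x y d)).re = 0) ∧
    ((∀ (x : Fin l → ℝ) (y : Fin m → ℝ), ∀ ξ ∈ tangentSpan r e f x y,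
        ∑ d, (ξ d * star (qj * psi r e f x y d)).re = 0) ↔
      ∀ p, ∑ d, r d ^ 2 * e d p = 0) := by
  have hX : ∀ (x : Fin l → ℝ) (y : Fin m → ℝ) (p : Fin l),
      ∑ d, (dpsiX r e f x y p d * star (qj * psi r e f x y d)).re
        = ∑ d, r d ^ 2 * e d p := fun x y p =>
    Finset.sum_congr rfl fun d _ => re_dpsiX_mul_star r e f x y p d
  have hY : ∀ (x : Fin l → ℝ) (y : Fin m → ℝ) (q : Fin m),
      ∑ d, (dpsiY r e f x y q d * star (qj * psi r e f x y d)).re = 0 := fun x y q =>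
    Finset.sum_eq_zero fun d _ => re_dpsiY_mul_star r e f x y q d
  refine ⟨hX, hY, fun h p => ?_, fun h x y ξ hξ => ?_⟩
  · rw [← hX 0 0 p]
    exact h 0 0 _ (Submodule.subset_span ⟨Sum.inl p, rfl⟩)
  · unfold tangentSpan at hξ
    induction hξ using Submodule.span_induction with
    | mem v hv =>
      obtain ⟨p | q, rfl⟩ := hv
      · exact (hX x y p).trans (h p)
      · exact hY x y q
    | zero => simp
    | add v w _ _ hv hw =>
      simp only [Pi.add_apply, add_mul, Quaternion.re_add, Finset.sum_add_distrib, hv, hw, add_zero]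
    | smul c v _ hv =>
      simp only [Pi.smul_apply, smul_mul_assoc, Quaternion.re_smul, ← Finset.smul_sum, hv,
        smul_zero]


end
end
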